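/- (Main theorem) Let 0 ≤ α < mn, 1 < p₁,…,p_m < ∞, 1/p = ∑ 1/p_i, 1/q = 1/p − α/n, and q ≥ max_i p_i. Let w₁,…,w_m, v be weights and σ_i = w_i^{1-p_i'}. Then the multilinear fractional maximal operator ℳ_α is bounded from L^{p₁}(w₁)×⋯×L^{p_m}(w_m) to L^q(v) if and only if [w⃗,v]_{S} := sup_Q (∫_Q ℳ_α(σ₁1_Q,…,σ_m1_Q)^q v dx)^{1/q} / ∏_i σ_i(Q)^{1/p_i} < ∞; moreover the operator norm is comparable to [w⃗,v]_S with constants depending only on m, n, α, p_i, q. -/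

import Mathlib

open MeasureTheory ENNReal Set
open scoped BigOperators

noncomputable section

abbrev Rn (n : ℕ) := Fin n → ℝ

/-- An axis-parallel half-open cube with corner `c` and side length `l`. -/
def cube {n : ℕ} (c : Rn n) (l : ℝ) : Set (Rn n) :=
  {x | ∀ i, c i ≤ x i ∧ x i < c i + l}

/-- `σ(Q) = ∫_Q σ dx`. -/
def wtI {n : ℕ} (σ : Rn n → ℝ≥0∞) (Q : Set (Rn n)) : ℝ≥0∞ := ∫⁻ x in Q, σ x

/-- `𝔼^σ_Q f = σ(Q)⁻¹ ∫_Q f σ`. -/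
def avgE {n : ℕ} (σ f : Rn n → ℝ≥0∞) (Q : Set (Rn n)) : ℝ≥0∞ :=
  (wtI σ Q)⁻¹ * ∫⁻ x in Q, f x * σ x

/-- The cube `2^{-k}([0,1)ⁿ + m + (-1)^k t)` of the shifted dyadic grid. -/
def gridCube (n : ℕ) (k : ℤ) (m : Fin n → ℤ) (t : Fin n → ℝ) : Set (Rn n) :=
  {x | ∀ i, (2:ℝ) ^ (-k) * ((m i : ℝ) + (-1:ℝ) ^ k * t i) ≤ x i ∧
       x i < (2:ℝ) ^ (-k) * ((m i : ℝ) + (-1:ℝ) ^ k * t i + 1)}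

/-- The shifted dyadic grid `𝒟_t`. -/
def shiftedGrid (n : ℕ) (t : Fin n → ℝ) : Set (Set (Rn n)) :=
  {Q | ∃ (k : ℤ) (m : Fin n → ℤ), Q = gridCube n k m t}

/-- Abstract dyadic grid: cubes of dyadic side lengths, nested or disjoint,
and for each scale the cubes of that side length cover `ℝⁿ`. -/
def IsDyadicGrid {n : ℕ} (𝒟 : Set (Set (Rn n))) : Prop :=
  (∀ Q ∈ 𝒟, ∃ (c : Rn n) (k : ℤ), Q = cube c ((2:ℝ) ^ k)) ∧
  (∀ Q ∈ 𝒟, ∀ R ∈ 𝒟, Q ∩ R = Q ∨ Q ∩ R = R ∨ Q ∩ R = ∅) ∧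
  (∀ k : ℤ, (⋃ Q ∈ {Q | Q ∈ 𝒟 ∧ ∃ c : Rn n, Q = cube c ((2:ℝ) ^ k)}, Q) = univ)

/-- The multilinear fractional maximal operator `ℳ_α`. -/
def MM (n m : ℕ) (α : ℝ) (g : Fin m → Rn n → ℝ≥0∞) (x : Rn n) : ℝ≥0∞ :=
  ⨆ (c : Rn n) (l : ℝ) (_ : 0 < l) (_ : x ∈ cube c l),
    ∏ i, (volume (cube c l) ^ (-(1 - α / ((m : ℝ) * (n : ℝ)))) * ∫⁻ y in cube c l, g i y)

/-- The multilinear fractional maximal operator restricted to a grid `𝒟`. -/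
def MMD (n m : ℕ) (α : ℝ) (𝒟 : Set (Set (Rn n))) (g : Fin m → Rn n → ℝ≥0∞)
    (x : Rn n) : ℝ≥0∞ :=
  ⨆ (Q : Set (Rn n)) (_ : Q ∈ 𝒟) (_ : x ∈ Q),
    ∏ i, (volume Q ^ (-(1 - α / ((m : ℝ) * (n : ℝ)))) * ∫⁻ y in Q, g i y)

/-- The bilinear fractional maximal operator `ℳ_α(g₁,g₂)`. -/
def M2 (n : ℕ) (α : ℝ) (g₁ g₂ : Rn n → ℝ≥0∞) (x : Rn n) : ℝ≥0∞ :=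
  ⨆ (c : Rn n) (l : ℝ) (_ : 0 < l) (_ : x ∈ cube c l),
    (volume (cube c l) ^ (-(1 - α / (2 * (n : ℝ)))) * ∫⁻ y in cube c l, g₁ y) *
      (volume (cube c l) ^ (-(1 - α / (2 * (n : ℝ)))) * ∫⁻ y in cube c l, g₂ y)

/-- The bilinear dyadic fractional maximal operator `ℳ^𝒟_α(g₁,g₂)`. -/
def M2D (n : ℕ) (α : ℝ) (𝒟 : Set (Set (Rn n))) (g₁ g₂ : Rn n → ℝ≥0∞) (x : Rn n) : ℝ≥0∞ :=
  ⨆ (Q : Set (Rn n)) (_ : Q ∈ 𝒟) (_ : x ∈ Q),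
    (volume Q ^ (-(1 - α / (2 * (n : ℝ)))) * ∫⁻ y in Q, g₁ y) *
      (volume Q ^ (-(1 - α / (2 * (n : ℝ)))) * ∫⁻ y in Q, g₂ y)

/-- Sawyer's bilinear testing constant `[w⃗,v]_{S_{P⃗,q}}`. -/
def sawyer2 (n : ℕ) (α p₁ p₂ q : ℝ) (σ₁ σ₂ v : Rn n → ℝ≥0∞) : ℝ≥0∞ :=
  ⨆ (c : Rn n) (l : ℝ) (_ : 0 < l),
    (∫⁻ x in cube c l,
        M2 n α ((cube c l).indicator σ₁) ((cube c l).indicator σ₂) x ^ q * v x) ^ (1/q) /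
      (wtI σ₁ (cube c l) ^ (1/p₁) * wtI σ₂ (cube c l) ^ (1/p₂))

/-- Sawyer's multilinear testing constant. -/
def sawyerM (n m : ℕ) (α q : ℝ) (p : Fin m → ℝ) (σ : Fin m → Rn n → ℝ≥0∞)
    (v : Rn n → ℝ≥0∞) : ℝ≥0∞ :=
  ⨆ (c : Rn n) (l : ℝ) (_ : 0 < l),
    (∫⁻ x in cube c l, MM n m α (fun i => (cube c l).indicator (σ i)) x ^ q * v x) ^ (1/q) /
      ∏ i, wtI (σ i) (cube c l) ^ (1 / p i)

/-- The principal cubes of `f` relative to `σ` inside `Qbar`, generation by generation. -/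
def principalCubes {n : ℕ} (𝒟 : Set (Set (Rn n))) (σ f : Rn n → ℝ≥0∞)
    (Qbar : Set (Rn n)) : ℕ → Set (Set (Rn n))
  | 0 => {Qbar}
  | k + 1 => {G' | G' ∈ 𝒟 ∧ ∃ G ∈ principalCubes 𝒟 σ f Qbar k, G' ⊆ G ∧
      4 * avgE σ f G < avgE σ f G' ∧
      ∀ G'' ∈ 𝒟, G' ⊆ G'' → G'' ⊆ G → 4 * avgE σ f G < avgE σ f G'' → G'' = G'}



lemma sum_rpow_le_aux {ι : Type*} (s : Finset ι) (x : ι → ℝ≥0∞) {r : ℝ} (hr : 1 ≤ r) :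
    ∑ j ∈ s, x j ^ r ≤ (∑ j ∈ s, x j) ^ r := by
  classical
  induction s using Finset.induction_on with
  | empty => simp
  | insert a s ha ih =>
    rw [Finset.sum_insert ha, Finset.sum_insert ha]
    exact (add_le_add le_rfl ih).trans (ENNReal.add_rpow_le_rpow_add _ _ hr)

lemma sum_prod_le_aux {ι : Type*} {m : ℕ} (hm : 0 < m) (s : Finset ι) (y : Fin m → ι → ℝ≥0∞) :
    ∑ j ∈ s, ∏ i, y i j ≤ ∏ i, ∑ j ∈ s, y i j := by
  classical
  rw [Finset.prod_univ_sum]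
  have hinj : Set.InjOn (fun (j : ι) (_ : Fin m) => j) (s : Set ι) := by
    intro a _ b _ h
    exact congrFun h ⟨0, hm⟩
  have := Finset.sum_image (f := fun g : Fin m → ι => ∏ i, y i (g i)) hinj
  rw [← this]
  apply Finset.sum_le_sum_of_subset
  intro g hg
  simp only [Finset.mem_image] at hg
  obtain ⟨j, hj, rfl⟩ := hg
  simp [hj]

/-- geometric constant -/
def geoC (s : ℝ) : ℝ≥0∞ := (1 - (2:ℝ≥0∞) ^ (-s))⁻¹

lemma two_neg_lt {s : ℝ} (hs : 0 < s) : (2:ℝ≥0∞) ^ (-s) < 1 :=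
  ENNReal.rpow_lt_one_of_one_lt_of_neg (by norm_num) (by linarith)

lemma geoC_ne_top {s : ℝ} (hs : 0 < s) : geoC s ≠ ∞ := by
  unfold geoC
  rw [ENNReal.inv_ne_top]
  exact (tsub_pos_of_lt (two_neg_lt hs)).ne'

lemma geo_sum (K : Finset ℤ) {s : ℝ} (hs : 0 < s) (t : ℝ≥0∞) :
    ∑ j ∈ K, (if (2:ℝ≥0∞) ^ (j:ℝ) < t then (2:ℝ≥0∞) ^ ((j:ℝ) * s) else 0) ≤ geoC s * t ^ s := by
  classical
  rw [← Finset.sum_filter]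
  set K' := K.filter (fun j : ℤ => (2:ℝ≥0∞) ^ (j:ℝ) < t) with hK'
  rcases K'.eq_empty_or_nonempty with h | h
  · simp [h]
  set J := K'.max' h with hJ
  have hJm : (2:ℝ≥0∞) ^ (J:ℝ) < t := (Finset.mem_filter.1 (K'.max'_mem h)).2
  have hle : ∀ j ∈ K', j ≤ J := fun j hj => K'.le_max' j hj
  have hinj : Set.InjOn (fun j : ℤ => (J - j).toNat) (K' : Set ℤ) := by
    intro a ha b hb hab
    have := hle a ha; have := hle b hb
    simp only at hab
    omega
  calc ∑ j ∈ K', (2:ℝ≥0∞) ^ ((j:ℝ) * s)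
      = ∑ j ∈ K', (2:ℝ≥0∞) ^ ((J:ℝ) * s) * ((2:ℝ≥0∞) ^ (-s)) ^ ((J - j).toNat) := by
        apply Finset.sum_congr rfl
        intro j hj
        rw [← ENNReal.rpow_natCast, ← ENNReal.rpow_mul, ← ENNReal.rpow_add _ _ (by simp) (by simp)]
        congr 1
        have h1 : (((J - j).toNat : ℤ)) = J - j := Int.toNat_of_nonneg (by have := hle j hj; omega)
        have h2 : (((J - j).toNat : ℝ)) = J - j := by exact_mod_cast congrArg (fun z : ℤ => (z:ℝ)) h1
        rw [h2]; ring
    _ = (2:ℝ≥0∞) ^ ((J:ℝ) * s) * ∑ j ∈ K', ((2:ℝ≥0∞) ^ (-s)) ^ ((J - j).toNat) := by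
        rw [Finset.mul_sum]
    _ = (2:ℝ≥0∞) ^ ((J:ℝ) * s) * ∑ i ∈ K'.image (fun j : ℤ => (J - j).toNat), ((2:ℝ≥0∞) ^ (-s)) ^ i := by
        rw [Finset.sum_image hinj]
    _ ≤ (2:ℝ≥0∞) ^ ((J:ℝ) * s) * geoC s := by
        gcongr
        rw [geoC, ← ENNReal.tsum_geometric]
        exact ENNReal.sum_le_tsum _
    _ ≤ geoC s * t ^ s := by
        rw [mul_comm, ENNReal.rpow_mul]
        gcongr

section laminar
variable {X : Type*} [MeasurableSpace X]

open Classical in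
def maxF (F : Finset (Set X)) : Finset (Set X) := F.filter (fun R => ∀ Q ∈ F, R ⊆ Q → Q = R)

lemma maxF_exists (F : Finset (Set X)) {Q : Set X} (hQ : Q ∈ F) : ∃ R ∈ maxF F, Q ⊆ R := by
  obtain ⟨R, hR, hmax⟩ := F.exists_le_maximal hQ
  refine ⟨R, ?_, hR⟩
  simp only [maxF, Finset.mem_filter]
  exact ⟨hmax.1, fun Q hQ h => le_antisymm (hmax.2 hQ h) h⟩

lemma maxF_sub (F : Finset (Set X)) : ∀ R ∈ maxF F, R ∈ F := by
  intro R hR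
  simp only [maxF, Finset.mem_filter] at hR
  exact hR.1

def Lam (F : Finset (Set X)) : Prop := ∀ Q ∈ F, ∀ R ∈ F, Q ⊆ R ∨ R ⊆ Q ∨ Disjoint Q R

lemma maxF_disj (F : Finset (Set X)) (h : Lam F) :
    Set.PairwiseDisjoint (maxF F : Set (Set X)) id := by
  intro Q hQ R hR hne
  simp only [maxF, Finset.coe_filter, Set.mem_ofPred_eq] at hQ hR
  rcases h Q hQ.1 R hR.1 with h | h | h
  · exact absurd (hQ.2 R hR.1 h).symm hne
  · exact absurd (hR.2 Q hQ.1 h) hne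
  · exact h

def avg (μ : Measure X) (f : X → ℝ≥0∞) (Q : Set X) : ℝ≥0∞ := (μ Q)⁻¹ * ∫⁻ x in Q, f x ∂μ

def Wk (μ : Measure X) (f : X → ℝ≥0∞) (k : ℤ) : ℝ≥0∞ :=
  (2:ℝ≥0∞) ^ (1 - (k:ℝ)) * ∫⁻ x in {x | (2:ℝ≥0∞) ^ (((k - 1 : ℤ)):ℝ) < f x}, f x ∂μ

lemma weak_type (μ : Measure X) (f : X → ℝ≥0∞) (hf : Measurable f) (k : ℤ) (H : Finset (Set X))
    (hd : Set.PairwiseDisjoint (H : Set (Set X)) id) (hmeas : ∀ R ∈ H, MeasurableSet R)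
    (hfin : ∀ R ∈ H, μ R ≠ ∞) (havg : ∀ R ∈ H, (2:ℝ≥0∞) ^ (k:ℝ) < avg μ f R) :
    ∑ R ∈ H, μ R ≤ Wk μ f k := by
  set A := {x | (2:ℝ≥0∞) ^ (((k - 1 : ℤ)):ℝ) < f x} with hA
  have hAm : MeasurableSet A := measurableSet_lt measurable_const hf
  set c := (2:ℝ≥0∞) ^ (((k - 1 : ℤ)):ℝ) with hc
  have hc2 : (2:ℝ≥0∞) ^ (k:ℝ) = c + c := by
    rw [hc, ← two_mul]
    conv_rhs => rw [← ENNReal.rpow_one 2]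
    rw [← ENNReal.rpow_mul, ← ENNReal.rpow_add _ _ (by simp) (by simp)]
    congr 1; push_cast; ring
  have hctop : c ≠ ∞ := by
    rw [hc]; exact ENNReal.rpow_ne_top_of_ne_zero (by simp) (by simp)
  have key : ∀ R ∈ H, c * μ R ≤ ∫⁻ x in R ∩ A, f x ∂μ := by
    intro R hR
    have h1 : (c + c) * μ R ≤ ∫⁻ x in R, f x ∂μ := by
      have := (havg R hR).le
      rw [hc2, avg, mul_comm, ← div_eq_mul_inv] at this
      exact ENNReal.mul_le_of_le_div this
    have h2 : ∫⁻ x in R, f x ∂μ ≤ ∫⁻ x in R ∩ A, f x ∂μ + c * μ R := by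
      rw [← lintegral_inter_add_sdiff f R hAm]
      gcongr
      calc ∫⁻ x in R \ A, f x ∂μ ≤ ∫⁻ x in R \ A, c ∂μ := by
            apply setLIntegral_mono measurable_const
            intro x hx
            exact not_lt.1 hx.2
        _ = c * μ (R \ A) := by simp
        _ ≤ c * μ R := by gcongr; exact sdiff_subset
    have h3 := h1.trans h2
    rw [add_mul] at h3
    exact (ENNReal.add_le_add_iff_right (ENNReal.mul_ne_top hctop (hfin R hR))).1 h3
  have hsum : c * ∑ R ∈ H, μ R ≤ ∫⁻ x in A, f x ∂μ := by
    rw [Finset.mul_sum]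
    refine (Finset.sum_le_sum key).trans ?_
    rw [← lintegral_biUnion_finset (t := fun R => R ∩ A)]
    · apply lintegral_mono_set
      simp
    · intro Q hQ R hR hne
      exact (hd hQ hR hne).mono inter_subset_left inter_subset_left
    · intro R hR; exact (hmeas R hR).inter hAm
  have h1 : (2:ℝ≥0∞) ^ (1 - (k:ℝ)) * c = 1 := by
    rw [hc, ← ENNReal.rpow_add _ _ (by simp) (by simp)]
    push_cast
    simp
  calc ∑ R ∈ H, μ R = (2:ℝ≥0∞) ^ (1 - (k:ℝ)) * (c * ∑ R ∈ H, μ R) := by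
        rw [← mul_assoc, h1, one_mul]
    _ ≤ _ := by unfold Wk; gcongr

def Cp (p : ℝ) : ℝ≥0∞ := (2:ℝ≥0∞) ^ (2 * p) * geoC (p - 1)

lemma Cp_ne_top {p : ℝ} (hp : 1 < p) : Cp p ≠ ∞ :=
  ENNReal.mul_ne_top (ENNReal.rpow_ne_top_of_ne_zero (by simp) (by simp))
    (geoC_ne_top (by linarith))

lemma strong_type (μ : Measure X) (f : X → ℝ≥0∞) (hf : Measurable f) (K : Finset ℤ)
    {p : ℝ} (hp : 1 < p) :
    ∑ k ∈ K, (2:ℝ≥0∞) ^ (((k:ℝ) + 1) * p) * Wk μ f k ≤ Cp p * ∫⁻ x, f x ^ p ∂μ := by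
  have hset : ∀ k : ℤ, MeasurableSet {x | (2:ℝ≥0∞) ^ (((k - 1 : ℤ)):ℝ) < f x} := fun k =>
    measurableSet_lt measurable_const hf
  have hterm : ∀ k ∈ K, (2:ℝ≥0∞) ^ (((k:ℝ) + 1) * p) * Wk μ f k =
      ∫⁻ x, (2:ℝ≥0∞) ^ (2 * p) * (f x *
        (if (2:ℝ≥0∞) ^ (((k - 1 : ℤ)):ℝ) < f x then (2:ℝ≥0∞) ^ ((((k - 1 : ℤ)):ℝ) * (p - 1)) else 0)) ∂μ := by
    intro k _
    unfold Wk
    rw [← lintegral_indicator (hset k), ← mul_assoc, ← ENNReal.rpow_add _ _ (by simp) (by simp),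
      ← lintegral_const_mul _ (hf.indicator (hset k))]
    apply lintegral_congr
    intro x
    by_cases hx : (2:ℝ≥0∞) ^ (((k - 1 : ℤ)):ℝ) < f x
    · rw [if_pos hx, Set.indicator_of_mem (by exact hx), mul_comm (f x), ← mul_assoc,
        ← ENNReal.rpow_add _ _ (by simp) (by simp)]
      congr 2
      push_cast; ring
    · rw [if_neg hx, Set.indicator_of_notMem (by exact hx)]; simp
  have hite : ∀ k : ℤ, Measurable (fun x => if (2:ℝ≥0∞) ^ (((k - 1 : ℤ)):ℝ) < f x then
      (2:ℝ≥0∞) ^ ((((k - 1 : ℤ)):ℝ) * (p - 1)) else 0) := fun k =>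
    Measurable.ite (hset k) measurable_const measurable_const
  rw [Finset.sum_congr rfl hterm, ← lintegral_finsetSum]
  · rw [← lintegral_const_mul _ (hf.pow_const p)]
    apply lintegral_mono
    intro x
    simp only
    rw [← Finset.mul_sum, ← Finset.mul_sum, Cp, mul_assoc]
    refine mul_le_mul_right ?_ _
    have h := geo_sum (K.image (fun k => k - 1)) (s := p - 1) (by linarith) (f x)
    rw [Finset.sum_image (by intro a _ b _ h; simpa using h)] at h
    calc _ ≤ f x * (geoC (p - 1) * f x ^ (p - 1)) := by gcongr
      _ = geoC (p - 1) * (f x ^ (1:ℝ) * f x ^ (p - 1)) := by rw [ENNReal.rpow_one]; ring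
      _ ≤ geoC (p - 1) * f x ^ p := by
        gcongr
        rw [← ENNReal.rpow_add_of_nonneg _ _ (by norm_num) (by linarith)]
        simp
  · intro k _
    exact (hf.mul (hite k)).const_mul _

lemma exists_K (F : Finset ℝ≥0∞) : ∃ K : Finset ℤ, ∀ t ∈ F, t ≠ 0 → t ≠ ∞ →
    ∃ k ∈ K, (2:ℝ≥0∞) ^ (k:ℝ) < t ∧ t ≤ (2:ℝ≥0∞) ^ ((k:ℝ) + 1) := by
  classical
  have : ∀ t : ℝ≥0∞, ∃ k : ℤ, t ≠ 0 → t ≠ ∞ →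
      (2:ℝ≥0∞) ^ (k:ℝ) < t ∧ t ≤ (2:ℝ≥0∞) ^ ((k:ℝ) + 1) := by
    intro t
    by_cases h0 : t = 0
    · exact ⟨0, fun h => absurd h0 h⟩
    by_cases h1 : t = ∞
    · exact ⟨0, fun _ h => absurd h1 h⟩
    obtain ⟨k, hk⟩ := ENNReal.exists_mem_Ioc_zpow (y := 2) h0 h1 (by norm_num) (by norm_num)
    refine ⟨k, fun _ _ => ⟨?_, ?_⟩⟩
    · rw [ENNReal.rpow_intCast]; exact hk.1
    · have := hk.2
      rw [← ENNReal.rpow_intCast] at this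
      exact_mod_cast this
  choose g hg using this
  exact ⟨F.image g, fun t ht h0 h1 => ⟨g t, Finset.mem_image_of_mem g ht, hg t h0 h1⟩⟩

lemma finite_main {m : ℕ} (hm : 0 < m) (μ : Fin m → Measure X) (ν : Measure X)
    (f : Fin m → X → ℝ≥0∞) (hf : ∀ i, Measurable (f i)) (p : Fin m → ℝ) (hp : ∀ i, 1 < p i)
    (q : ℝ) (hqp : ∀ i, p i ≤ q) (B : Set X → ℝ≥0∞) (T : ℝ≥0∞)
    (F : Finset (Set X)) (hmeas : ∀ R ∈ F, MeasurableSet R) (hlam : Lam F)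
    (hfin : ∀ R ∈ F, ∀ i, μ i R ≠ ∞) (hfint : ∀ R ∈ F, ∀ i, ∫⁻ x in R, f i x ∂(μ i) ≠ ∞)
    (hT : ∀ R ∈ F, (∀ i, μ i R ≠ 0) →
      ∫⁻ x, (⨆ Q ∈ F, ⨆ (_ : Q ⊆ R), Q.indicator (fun _ => B Q) x) ∂ν
        ≤ T * ∏ i, (μ i R) ^ (q / p i)) :
    ∫⁻ x, (⨆ Q ∈ F, Q.indicator (fun _ => B Q * ∏ i, (avg (μ i) (f i) Q) ^ q) x) ∂ν
      ≤ T * ∏ i, (Cp (p i) * ∫⁻ x, f i x ^ p i ∂(μ i)) ^ (q / p i) := by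
  classical
  have hq : 0 < q := by have := hp ⟨0, hm⟩; have := hqp ⟨0, hm⟩; linarith
  obtain ⟨K, hK⟩ := exists_K ((F ×ˢ Finset.univ).image (fun z : Set X × Fin m => avg (μ z.2) (f z.2) z.1))
  have havtop : ∀ R ∈ F, ∀ i, avg (μ i) (f i) R ≠ ∞ := by
    intro R hR i
    unfold avg
    by_cases h0 : μ i R = 0
    · rw [Measure.restrict_eq_zero.2 h0]; simp
    · exact ENNReal.mul_ne_top (ENNReal.inv_ne_top.2 h0) (hfint R hR i)
  set Fk : (Fin m → ℤ) → Finset (Set X) := fun k =>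
    F.filter (fun Q => ∀ i, (2:ℝ≥0∞) ^ ((k i : ℤ):ℝ) < avg (μ i) (f i) Q) with hFk
  have hFkF : ∀ k, ∀ Q ∈ Fk k, Q ∈ F := fun k Q hQ => (Finset.mem_filter.1 hQ).1
  have hFkav : ∀ k, ∀ Q ∈ Fk k, ∀ i, (2:ℝ≥0∞) ^ ((k i : ℤ):ℝ) < avg (μ i) (f i) Q :=
    fun k Q hQ => (Finset.mem_filter.1 hQ).2
  set N : Set X → X → ℝ≥0∞ := fun R x =>
    ⨆ Q ∈ F, ⨆ (_ : Q ⊆ R), Q.indicator (fun _ => B Q) x with hN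
  have hNm : ∀ R, Measurable (N R) := by
    intro R
    refine Measurable.biSup (F : Set (Set X)) F.countable_toSet ?_
    intro Q hQ
    refine Measurable.iSup_Prop _ ?_
    exact measurable_const.indicator (hmeas Q hQ)
  have hpt : ∀ x, (⨆ Q ∈ F, Q.indicator (fun _ => B Q * ∏ i, (avg (μ i) (f i) Q) ^ q) x) ≤
      ∑ k ∈ Fintype.piFinset (fun _ : Fin m => K),
        (∏ i, (2:ℝ≥0∞) ^ (((k i : ℝ) + 1) * q)) * ∑ R ∈ maxF (Fk k), N R x := by
    intro x
    refine iSup₂_le ?_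
    intro Q hQ
    by_cases hx : x ∈ Q
    swap
    · rw [Set.indicator_of_notMem hx]; exact zero_le
    rw [Set.indicator_of_mem hx]
    by_cases h0 : ∃ i, avg (μ i) (f i) Q = 0
    · obtain ⟨i, hi⟩ := h0
      rw [Finset.prod_eq_zero (Finset.mem_univ i) (by rw [hi, ENNReal.zero_rpow_of_pos hq])]
      simp
    push Not at h0
    have : ∀ i, ∃ k ∈ K, (2:ℝ≥0∞) ^ (k:ℝ) < avg (μ i) (f i) Q ∧
        avg (μ i) (f i) Q ≤ (2:ℝ≥0∞) ^ ((k:ℝ) + 1) := by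
      intro i
      refine hK _ ?_ (h0 i) (havtop Q hQ i)
      exact Finset.mem_image.2 ⟨(Q, i), by simp [hQ], rfl⟩
    choose k hkK hk1 hk2 using this
    have hQk : Q ∈ Fk k := Finset.mem_filter.2 ⟨hQ, hk1⟩
    obtain ⟨R, hR, hQR⟩ := maxF_exists (Fk k) hQk
    have hBN : B Q ≤ N R x := by
      have h1 : Q.indicator (fun _ => B Q) x = B Q := Set.indicator_of_mem hx _
      refine le_trans ?_ (le_iSup₂_of_le Q hQ (le_iSup_of_le hQR le_rfl))
      exact h1.ge
    calc B Q * ∏ i, (avg (μ i) (f i) Q) ^ q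
        ≤ (∏ i, (2:ℝ≥0∞) ^ (((k i : ℝ) + 1) * q)) * ∑ R ∈ maxF (Fk k), N R x := by
          rw [mul_comm]
          gcongr with i
          · rw [ENNReal.rpow_mul]
            exact ENNReal.rpow_le_rpow (hk2 i) hq.le
          · exact hBN.trans (Finset.single_le_sum (f := fun R => N R x) (fun _ _ => zero_le) hR)
      _ ≤ _ := Finset.single_le_sum (f := fun k : Fin m → ℤ =>
          (∏ i, (2:ℝ≥0∞) ^ (((k i : ℝ) + 1) * q)) * ∑ R ∈ maxF (Fk k), N R x)
          (fun _ _ => zero_le) (by simpa using hkK)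
  calc ∫⁻ x, (⨆ Q ∈ F, Q.indicator (fun _ => B Q * ∏ i, (avg (μ i) (f i) Q) ^ q) x) ∂ν
      ≤ ∫⁻ x, ∑ k ∈ Fintype.piFinset (fun _ : Fin m => K),
        (∏ i, (2:ℝ≥0∞) ^ (((k i : ℝ) + 1) * q)) * ∑ R ∈ maxF (Fk k), N R x ∂ν := lintegral_mono hpt
    _ = ∑ k ∈ Fintype.piFinset (fun _ : Fin m => K),
        (∏ i, (2:ℝ≥0∞) ^ (((k i : ℝ) + 1) * q)) * ∑ R ∈ maxF (Fk k), ∫⁻ x, N R x ∂ν := by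
        rw [lintegral_finsetSum]
        · apply Finset.sum_congr rfl
          intro k _
          rw [lintegral_const_mul _ (Finset.measurable_fun_sum _ (fun R _ => hNm R)),
            lintegral_finsetSum _ (fun R _ => hNm R)]
        · intro k _
          exact (Finset.measurable_fun_sum _ (fun R _ => hNm R)).const_mul _
    _ ≤ ∑ k ∈ Fintype.piFinset (fun _ : Fin m => K),
        (∏ i, (2:ℝ≥0∞) ^ (((k i : ℝ) + 1) * q)) * (T * ∏ i, (Wk (μ i) (f i) (k i)) ^ (q / p i)) := by
        gcongr with k _
        calc ∑ R ∈ maxF (Fk k), ∫⁻ x, N R x ∂ν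
            ≤ ∑ R ∈ maxF (Fk k), T * ∏ i, (μ i R) ^ (q / p i) := by
              apply Finset.sum_le_sum
              intro R hR
              have hRk := maxF_sub _ R hR
              refine hT R (hFkF k R hRk) ?_
              intro i h0
              have := hFkav k R hRk i
              rw [avg, Measure.restrict_eq_zero.2 h0] at this
              simp at this
          _ = T * ∑ R ∈ maxF (Fk k), ∏ i, (μ i R) ^ (q / p i) := by rw [Finset.mul_sum]
          _ ≤ T * ∏ i, ∑ R ∈ maxF (Fk k), (μ i R) ^ (q / p i) := by
              gcongr; exact sum_prod_le_aux hm _ _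
          _ ≤ T * ∏ i, (∑ R ∈ maxF (Fk k), (μ i R)) ^ (q / p i) := by
              gcongr with i
              apply sum_rpow_le_aux
              rw [le_div_iff₀ (by linarith [hp i])]; linarith [hqp i]
          _ ≤ T * ∏ i, (Wk (μ i) (f i) (k i)) ^ (q / p i) := by
              gcongr with i
              · exact div_nonneg hq.le (by linarith [hp i])
              apply weak_type _ _ (hf i)
              · apply maxF_disj
                intro Q hQ R hR
                exact hlam Q (hFkF k Q hQ) R (hFkF k R hR)
              · intro R hR; exact hmeas R (hFkF k R (maxF_sub _ R hR))
              · intro R hR; exact hfin R (hFkF k R (maxF_sub _ R hR)) i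
              · intro R hR; exact hFkav k R (maxF_sub _ R hR) i
    _ = T * ∏ i, ∑ k ∈ K, ((2:ℝ≥0∞) ^ (((k : ℝ) + 1) * p i) * Wk (μ i) (f i) k) ^ (q / p i) := by
        rw [Finset.prod_univ_sum, Finset.mul_sum]
        apply Finset.sum_congr rfl
        intro k _
        rw [mul_left_comm, ← Finset.prod_mul_distrib]
        congr 1
        apply Finset.prod_congr rfl
        intro i _
        have hpi : p i ≠ 0 := by linarith [hp i]
        rw [ENNReal.mul_rpow_of_nonneg _ _ (div_nonneg hq.le (by linarith [hp i])), ← ENNReal.rpow_mul]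
        congr 2
        field_simp
    _ ≤ T * ∏ i, (∑ k ∈ K, ((2:ℝ≥0∞) ^ (((k : ℝ) + 1) * p i) * Wk (μ i) (f i) k)) ^ (q / p i) := by
        gcongr with i
        apply sum_rpow_le_aux
        rw [le_div_iff₀ (by linarith [hp i])]; linarith [hqp i]
    _ ≤ _ := by
        gcongr with i
        · exact div_nonneg hq.le (by linarith [hp i])
        exact strong_type _ _ (hf i) K (hp i)

end laminar

/-! ### Shifted dyadic grids -/

def fl (s k : ℤ) (y : ℝ) : ℤ := ⌊(2:ℝ) ^ k * y - (-1:ℝ) ^ k * ((s:ℝ) / 3)⌋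

lemma neg_one_zpow_int (k : ℤ) : (-1:ℝ) ^ k = 1 ∨ (-1:ℝ) ^ k = -1 := by
  rcases Int.even_or_odd k with h | h
  · left; exact h.neg_one_zpow
  · right; exact h.neg_one_zpow

lemma fl_pred (s k : ℤ) : ∃ a : ℤ, ∀ y : ℝ, fl s (k - 1) y = (fl s k y + a) / 2 := by
  have key : ∀ a : ℤ, (a:ℝ) = (-1:ℝ) ^ k * s → ∀ y : ℝ, fl s (k - 1) y = (fl s k y + a) / 2 := by
    intro a ha y
    unfold fl
    rw [← Int.floor_add_intCast, ha]
    have h2 : (2:ℝ) ^ (k - 1) = 2 ^ k / 2 := by rw [zpow_sub_one₀ (by norm_num)]; ring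
    have h3 : (-1:ℝ) ^ (k - 1) = - (-1) ^ k := by rw [zpow_sub_one₀ (by norm_num)]; norm_num
    have h4 := Int.floor_div_natCast ((2:ℝ) ^ k * y - (-1:ℝ) ^ k * ((s:ℝ) / 3) + (-1:ℝ) ^ k * s) 2
    push_cast at h4
    rw [← h4, h2, h3]
    congr 1
    ring
  rcases neg_one_zpow_int k with h | h
  · exact ⟨s, key s (by rw [h]; ring)⟩
  · exact ⟨-s, key (-s) (by rw [h]; push_cast; ring)⟩

lemma fl_mono (s k : ℤ) (d : ℕ) {x y : ℝ} (h : fl s k x = fl s k y) :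
    fl s (k - d) x = fl s (k - d) y := by
  induction d with
  | zero => simpa using h
  | succ d ih =>
    obtain ⟨a, ha⟩ := fl_pred s (k - d)
    have : k - ((d + 1 : ℕ) : ℤ) = k - d - 1 := by push_cast; ring
    rw [this, ha, ha, ih]

section gridsec
variable {n : ℕ}

def gc (s : Fin n → Fin 2) (k : ℤ) (a : Fin n → ℤ) : Set (Rn n) :=
  {x | ∀ i, fl ((s i : ℕ) : ℤ) k (x i) = a i}

def grid (s : Fin n → Fin 2) : Set (Set (Rn n)) := Set.range (fun z : ℤ × (Fin n → ℤ) => gc s z.1 z.2)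

lemma gc_cube (s : Fin n → Fin 2) (k : ℤ) (a : Fin n → ℤ) :
    ∃ c : Rn n, gc s k a = cube c ((2:ℝ) ^ (-k)) := by
  refine ⟨fun i => (2:ℝ) ^ (-k) * (a i + (-1:ℝ) ^ k * (((s i : ℕ) : ℝ) / 3)), ?_⟩
  ext x
  simp only [gc, cube, Set.mem_ofPred_eq]
  refine forall_congr' fun i => ?_
  unfold fl
  rw [Int.floor_eq_iff]
  have h2 : (0:ℝ) < 2 ^ k := by positivity
  have hx : x i = (2:ℝ) ^ (-k) * (2 ^ k * x i) := by
    rw [← mul_assoc, ← zpow_add₀ (by norm_num)]; simp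
  have h3 : (0:ℝ) < 2 ^ (-k) := by positivity
  generalize (-1:ℝ) ^ k = e
  constructor
  · rintro ⟨ha, hb⟩
    rw [hx]
    push_cast at ha hb
    constructor
    · gcongr; linarith
    · have : (2:ℝ) ^ (-k) * (2 ^ k * x i) <
        (2:ℝ) ^ (-k) * (a i + e * (((s i : ℕ) : ℝ) / 3) + 1) := by
          gcongr; linarith
      linarith
  · rintro ⟨ha, hb⟩
    rw [hx] at ha hb
    have h1 := le_of_mul_le_mul_left ha h3
    have h4 : (2:ℝ) ^ (-k) * (2 ^ k * x i) <
        (2:ℝ) ^ (-k) * (a i + e * (((s i : ℕ) : ℝ) / 3) + 1) := by linarith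
    have h5 := lt_of_mul_lt_mul_left h4 h3.le
    push_cast
    constructor <;> linarith

lemma gc_nested (s : Fin n → Fin 2) (k j : ℤ) (a b : Fin n → ℤ) (hjk : j ≤ k) :
    gc s k a ⊆ gc s j b ∨ Disjoint (gc s k a) (gc s j b) := by
  by_cases h : Disjoint (gc s k a) (gc s j b)
  · exact Or.inr h
  left
  rw [Set.not_disjoint_iff] at h
  obtain ⟨y, hy1, hy2⟩ := h
  intro x hx i
  rw [← hy2 i]
  obtain ⟨d, rfl⟩ : ∃ d : ℕ, j = k - d := ⟨(k - j).toNat, by omega⟩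
  apply fl_mono
  rw [hx i, hy1 i]

lemma grid_lam (s : Fin n → Fin 2) (F : Finset (Set (Rn n))) (hF : ∀ Q ∈ F, Q ∈ grid s) : Lam F := by
  intro Q hQ R hR
  obtain ⟨⟨k, a⟩, rfl⟩ := hF Q hQ
  obtain ⟨⟨j, b⟩, rfl⟩ := hF R hR
  simp only
  rcases le_total j k with h | h
  · rcases gc_nested s k j a b h with h | h
    · exact Or.inl h
    · exact Or.inr (Or.inr h)
  · rcases gc_nested s j k b a h with h | h
    · exact Or.inr (Or.inl h)
    · exact Or.inr (Or.inr h.symm)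

lemma third_aux (k : ℤ) (y l : ℝ) (hl : (2:ℝ) ^ k * l ≤ 1 / 3) :
    ∃ s : Fin 2, ∀ x, y ≤ x → x < y + l → fl ((s : ℕ) : ℤ) k x = fl ((s : ℕ) : ℤ) k y := by
  have h2 : (0:ℝ) < 2 ^ k := by positivity
  have hmul : ∀ x, y ≤ x → x < y + l → (2:ℝ) ^ k * y ≤ 2 ^ k * x ∧ 2 ^ k * x < 2 ^ k * y + 1/3 := by
    intro x hx1 hx2
    constructor
    · gcongr
    · have : (2:ℝ) ^ k * x < 2 ^ k * (y + l) := by gcongr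
      linarith
  have hfl1 := Int.floor_le ((2:ℝ) ^ k * y)
  have hfl2 := Int.lt_floor_add_one ((2:ℝ) ^ k * y)
  by_cases hfr : (2:ℝ) ^ k * y < ⌊(2:ℝ) ^ k * y⌋ + 2 / 3
  · refine ⟨0, fun x hx1 hx2 => ?_⟩
    obtain ⟨h3, h4⟩ := hmul x hx1 hx2
    unfold fl
    simp only [Fin.val_zero, Nat.cast_zero, Int.cast_zero, zero_div, mul_zero, sub_zero]
    rw [Int.floor_eq_iff]
    constructor <;> linarith
  · refine ⟨1, fun x hx1 hx2 => ?_⟩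
    obtain ⟨h3, h4⟩ := hmul x hx1 hx2
    unfold fl
    simp only [Fin.val_one, Nat.cast_one, Int.cast_one]
    rcases neg_one_zpow_int k with h | h
    · rw [h]
      have e : ⌊(2:ℝ) ^ k * y - 1 * (1 / 3)⌋ = ⌊(2:ℝ) ^ k * y⌋ := by
        rw [Int.floor_eq_iff]; constructor <;> linarith
      rw [e, Int.floor_eq_iff]; constructor <;> linarith
    · rw [h]
      have e : ⌊(2:ℝ) ^ k * y - -1 * (1 / 3)⌋ = ⌊(2:ℝ) ^ k * y⌋ + 1 := by
        rw [Int.floor_eq_iff]; push_cast; constructor <;> linarith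
      rw [e, Int.floor_eq_iff]; push_cast; constructor <;> linarith

lemma one_third (c : Rn n) (l : ℝ) (hl : 0 < l) :
    ∃ (s : Fin n → Fin 2) (c' : Rn n) (L : ℝ), 0 < L ∧ L < 6 * l ∧ cube c' L ∈ grid s ∧
      cube c l ⊆ cube c' L := by
  obtain ⟨j, hj1, hj2⟩ := exists_mem_Ioc_zpow (x := 6 * l) (y := (2:ℝ)) (by positivity) (by norm_num)
  rw [zpow_add_one₀ (by norm_num)] at hj2
  have h2 : (0:ℝ) < 2 ^ j := by positivity
  have hl3 : (2:ℝ) ^ (-j) * l ≤ 1 / 3 := by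
    rw [zpow_neg, inv_mul_le_iff₀ h2]; linarith
  have := fun i => third_aux (-j) (c i) l hl3
  choose s hs using this
  obtain ⟨c', hc'⟩ := gc_cube s (-j) (fun i => fl ((s i : ℕ) : ℤ) (-j) (c i))
  rw [neg_neg] at hc'
  refine ⟨s, c', (2:ℝ) ^ j, h2, hj1, ?_, ?_⟩
  · rw [← hc']; exact ⟨(_, _), rfl⟩
  · rw [← hc']
    intro x hx i
    exact hs i (x i) (hx i).1 (hx i).2

lemma cube_eq_pi (c : Rn n) (l : ℝ) : cube c l = Set.univ.pi (fun i => Ico (c i) (c i + l)) := by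
  ext x; simp [cube]

lemma cube_meas (c : Rn n) (l : ℝ) : MeasurableSet (cube c l) := by
  rw [cube_eq_pi]; exact MeasurableSet.univ_pi (fun i => measurableSet_Ico)

lemma cube_vol (c : Rn n) (l : ℝ) : volume (cube c l) = ENNReal.ofReal l ^ n := by
  rw [cube_eq_pi, Real.volume_pi_Ico]; simp

lemma grid_cube (s : Fin n → Fin 2) {Q : Set (Rn n)} (hQ : Q ∈ grid s) :
    ∃ (c : Rn n) (l : ℝ), 0 < l ∧ Q = cube c l := by
  obtain ⟨⟨k, a⟩, rfl⟩ := hQ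
  obtain ⟨c, hc⟩ := gc_cube s k a
  exact ⟨c, _, by positivity, hc⟩

/-- the quantity in the definition of the maximal operator -/
def AA (m : ℕ) (α : ℝ) (g : Fin m → Rn n → ℝ≥0∞) (Q : Set (Rn n)) : ℝ≥0∞ :=
  ∏ i, (volume Q ^ (-(1 - α / ((m : ℝ) * (n : ℝ)))) * ∫⁻ y in Q, g i y)

lemma MM_le (m : ℕ) (α : ℝ) (hβ : 0 < 1 - α / ((m : ℝ) * (n : ℝ)))
    (g : Fin m → Rn n → ℝ≥0∞) (q : ℝ) (hq : 0 < q) (x : Rn n) :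
    MM n m α g x ^ q ≤
      ((∏ _i : Fin m, ((6:ℝ≥0∞) ^ n) ^ (1 - α / ((m : ℝ) * (n : ℝ)))) ^ q) *
        ∑ s : Fin n → Fin 2, ⨆ F : Finset (grid s),
          ⨆ Q ∈ F.map (Function.Embedding.subtype _), Set.indicator Q (fun _ => AA m α g Q ^ q) x := by
  set D := ∏ _i : Fin m, ((6:ℝ≥0∞) ^ n) ^ (1 - α / ((m : ℝ) * (n : ℝ))) with hD
  rw [← ENNReal.le_rpow_inv_iff hq]
  unfold MM
  refine iSup_le fun c => iSup_le fun l => iSup_le fun hl => iSup_le fun hx => ?_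
  rw [ENNReal.le_rpow_inv_iff hq]
  obtain ⟨s, c', L, hL, hL6, hgr, hsub⟩ := one_third c l hl
  set Q := cube c' L with hQ
  have h1 : (∏ i, (volume (cube c l) ^ (-(1 - α / ((m : ℝ) * (n : ℝ)))) * ∫⁻ y in cube c l, g i y))
      ≤ D * AA m α g Q := by
    rw [hD, AA, ← Finset.prod_mul_distrib]
    refine Finset.prod_le_prod' fun i _ => ?_
    rw [← mul_assoc]
    refine mul_le_mul' ?_ (lintegral_mono_set hsub)
    have hvol : volume Q ≤ (6:ℝ≥0∞) ^ n * volume (cube c l) := by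
      rw [hQ, cube_vol, cube_vol, ← mul_pow]
      gcongr
      calc ENNReal.ofReal L ≤ ENNReal.ofReal (6 * l) := ENNReal.ofReal_le_ofReal hL6.le
        _ = 6 * ENNReal.ofReal l := by rw [ENNReal.ofReal_mul (by norm_num)]; simp
    generalize 1 - α / ((m : ℝ) * (n : ℝ)) = β at *
    have hv0 : volume (cube c l) ≠ 0 := by
      rw [cube_vol]; simp [hl]
    have hvt : volume (cube c l) ≠ ∞ := by
      rw [cube_vol]; finiteness
    have hQ0 : volume Q ≠ 0 := by
      rw [hQ, cube_vol]; simp [hL]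
    have hQt : volume Q ≠ ∞ := by
      rw [hQ, cube_vol]; finiteness
    have h3 : volume Q ^ β ≤ ((6:ℝ≥0∞) ^ n) ^ β * volume (cube c l) ^ β := by
      rw [← ENNReal.mul_rpow_of_nonneg _ _ hβ.le]
      exact ENNReal.rpow_le_rpow hvol hβ.le
    have e1 : volume Q ^ β * volume Q ^ (-β) = 1 := by
      rw [← ENNReal.rpow_add _ _ hQ0 hQt]; simp
    have e2 : volume (cube c l) ^ β * volume (cube c l) ^ (-β) = 1 := by
      rw [← ENNReal.rpow_add _ _ hv0 hvt]; simp
    calc volume (cube c l) ^ (-β) = (volume Q ^ β * volume Q ^ (-β)) * volume (cube c l) ^ (-β) := by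
          rw [e1, one_mul]
      _ ≤ ((((6:ℝ≥0∞) ^ n) ^ β * volume (cube c l) ^ β) * volume Q ^ (-β)) * volume (cube c l) ^ (-β) := by
          gcongr
      _ = ((6:ℝ≥0∞) ^ n) ^ β * volume Q ^ (-β) * (volume (cube c l) ^ β * volume (cube c l) ^ (-β)) := by
          ring
      _ = _ := by rw [e2, mul_one]
  calc _ ≤ (D * AA m α g Q) ^ q := ENNReal.rpow_le_rpow h1 hq.le
    _ = D ^ q * AA m α g Q ^ q := ENNReal.mul_rpow_of_nonneg _ _ hq.le
    _ ≤ _ := by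
      gcongr
      refine le_trans ?_ (Finset.single_le_sum (f := fun s : Fin n → Fin 2 =>
        ⨆ F : Finset (grid s), ⨆ Q ∈ F.map (Function.Embedding.subtype _),
          Set.indicator Q (fun _ => AA m α g Q ^ q) x) (fun _ _ => zero_le) (Finset.mem_univ s))
      refine le_iSup_of_le {⟨Q, hgr⟩} (le_iSup₂_of_le Q (by simp) ?_)
      rw [Set.indicator_of_mem (hsub hx)]

lemma AA_le_MM (m : ℕ) (α : ℝ) (g : Fin m → Rn n → ℝ≥0∞) (c : Rn n) (l : ℝ) (hl : 0 < l)
    (x : Rn n) (hx : x ∈ cube c l) : AA m α g (cube c l) ≤ MM n m α g x :=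
  le_iSup_of_le c (le_iSup_of_le l (le_iSup_of_le hl (le_iSup_of_le hx le_rfl)))

/-- testing inequality for the finite family -/
lemma testing_ineq (m : ℕ) (hm : 0 < m) (α q : ℝ) (p : Fin m → ℝ) (hp : ∀ i, 1 < p i)
    (hqp : ∀ i, p i ≤ q) (σ : Fin m → Rn n → ℝ≥0∞) (v : Rn n → ℝ≥0∞) (hv : Measurable v)
    (hfin : ∀ i (c : Rn n) (l : ℝ), wtI (σ i) (cube c l) ≠ ∞)
    (s : Fin n → Fin 2) (F : Finset (Set (Rn n))) (hF : ∀ Q ∈ F, Q ∈ grid s)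
    (R : Set (Rn n)) (hR : R ∈ F) (hR0 : ∀ i, wtI (σ i) R ≠ 0) :
    ∫⁻ x, (⨆ Q ∈ F, ⨆ (_ : Q ⊆ R), Q.indicator (fun _ => AA m α σ Q ^ q) x) ∂(volume.withDensity v)
      ≤ sawyerM n m α q p σ v ^ q * ∏ i, (wtI (σ i) R) ^ (q / p i) := by
  have hq : 0 < q := by have := hp ⟨0, hm⟩; have := hqp ⟨0, hm⟩; linarith
  have hmeasF : ∀ Q ∈ F, MeasurableSet Q := by
    intro Q hQ
    obtain ⟨c, l, _, rfl⟩ := grid_cube s (hF Q hQ)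
    exact cube_meas c l
  have hNm : Measurable (fun x => ⨆ Q ∈ F, ⨆ (_ : Q ⊆ R), Q.indicator (fun _ => AA m α σ Q ^ q) x) := by
    refine Measurable.biSup (F : Set (Set (Rn n))) F.countable_toSet ?_
    intro Q hQ
    refine Measurable.iSup_Prop _ ?_
    exact measurable_const.indicator (hmeasF Q hQ)
  rw [lintegral_withDensity_eq_lintegral_mul _ hv hNm]
  obtain ⟨c, l, hl, hRc⟩ := grid_cube s (hF R hR)
  have h1 : ∫⁻ x, (v * fun x => ⨆ Q ∈ F, ⨆ (_ : Q ⊆ R), Q.indicator (fun _ => AA m α σ Q ^ q) x) x ≤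
      ∫⁻ x in R, MM n m α (fun i => R.indicator (σ i)) x ^ q * v x := by
    rw [← lintegral_indicator (hmeasF R hR)]
    apply lintegral_mono
    intro x
    simp only [Pi.mul_apply]
    by_cases hx : x ∈ R
    · rw [Set.indicator_of_mem hx, mul_comm]
      gcongr
      refine iSup₂_le fun Q hQ => iSup_le fun hQR => ?_
      by_cases hxQ : x ∈ Q
      · rw [Set.indicator_of_mem hxQ]
        refine ENNReal.rpow_le_rpow ?_ hq.le
        have e : AA m α σ Q = AA m α (fun i => R.indicator (σ i)) Q := by
          unfold AA
          refine Finset.prod_congr rfl fun i _ => ?_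
          congr 1
          refine setLIntegral_congr_fun (hmeasF Q hQ) fun y hy => ?_
          exact (Set.indicator_of_mem (hQR hy) _).symm
        rw [e]
        obtain ⟨c', l', hl', hQc⟩ := grid_cube s (hF Q hQ)
        rw [hQc] at hxQ ⊢
        exact AA_le_MM m α _ c' l' hl' x hxQ
      · rw [Set.indicator_of_notMem hxQ]; exact zero_le
    · have : (⨆ Q ∈ F, ⨆ (_ : Q ⊆ R), Q.indicator (fun _ => AA m α σ Q ^ q) x) = 0 := by
        rw [← nonpos_iff_eq_zero]
        refine iSup₂_le fun Q hQ => iSup_le fun hQR => ?_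
        rw [Set.indicator_of_notMem (fun h => hx (hQR h))]
      rw [this]; simp
  refine h1.trans ?_
  have h2 : (∫⁻ x in R, MM n m α (fun i => R.indicator (σ i)) x ^ q * v x) ^ (1/q) /
      ∏ i, wtI (σ i) R ^ (1 / p i) ≤ sawyerM n m α q p σ v := by
    rw [hRc]
    exact le_iSup_of_le c (le_iSup_of_le l (le_iSup_of_le hl le_rfl))
  have hfinR : ∀ i, wtI (σ i) R ≠ ∞ := fun i => by rw [hRc]; exact hfin i c l
  have hb0 : ∏ i, wtI (σ i) R ^ (1 / p i) ≠ 0 := by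
    rw [Finset.prod_ne_zero_iff]
    intro i _
    rw [Ne, ENNReal.rpow_eq_zero_iff_of_pos (by have := hp i; positivity)]
    exact hR0 i
  have hbt : ∏ i, wtI (σ i) R ^ (1 / p i) ≠ ∞ := by
    apply ENNReal.prod_ne_top
    intro i _
    exact ENNReal.rpow_ne_top_of_nonneg (by have := hp i; positivity) (hfinR i)
  rw [ENNReal.div_le_iff hb0 hbt, one_div, ENNReal.rpow_inv_le_iff hq,
    ENNReal.mul_rpow_of_nonneg _ _ hq.le, ← ENNReal.prod_rpow_of_nonneg hq.le] at h2
  refine h2.trans (le_of_eq ?_)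
  congr 1
  refine Finset.prod_congr rfl fun i _ => ?_
  rw [← ENNReal.rpow_mul]
  congr 1
  ring

lemma grid_bound (m : ℕ) (hm : 0 < m) (α q : ℝ) (p : Fin m → ℝ) (hp : ∀ i, 1 < p i)
    (hqp : ∀ i, p i ≤ q) (σ : Fin m → Rn n → ℝ≥0∞) (hσ : ∀ i, Measurable (σ i))
    (v : Rn n → ℝ≥0∞) (hv : Measurable v)
    (hfin : ∀ i (c : Rn n) (l : ℝ), wtI (σ i) (cube c l) ≠ ∞)
    (f : Fin m → Rn n → ℝ≥0∞) (hf : ∀ i, Measurable (f i))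
    (hfp : ∀ i, ∫⁻ x, f i x ^ p i * σ i x ≠ ∞)
    (s : Fin n → Fin 2) (F : Finset (Set (Rn n))) (hF : ∀ Q ∈ F, Q ∈ grid s) :
    ∫⁻ x, (⨆ Q ∈ F, Set.indicator Q (fun _ => AA m α (fun i y => f i y * σ i y) Q ^ q) x)
        ∂(volume.withDensity v)
      ≤ sawyerM n m α q p σ v ^ q *
        ∏ i, (Cp (p i) * ∫⁻ x, f i x ^ p i * σ i x) ^ (q / p i) := by
  have hq : 0 < q := by have := hp ⟨0, hm⟩; have := hqp ⟨0, hm⟩; linarith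
  set μ : Fin m → Measure (Rn n) := fun i => volume.withDensity (σ i) with hμ
  have hmeasF : ∀ Q ∈ F, MeasurableSet Q := by
    intro Q hQ
    obtain ⟨c, l, _, rfl⟩ := grid_cube s (hF Q hQ)
    exact cube_meas c l
  have hμQ : ∀ Q ∈ F, ∀ i, μ i Q = wtI (σ i) Q := fun Q hQ i =>
    withDensity_apply _ (hmeasF Q hQ)
  have hμt : ∀ Q ∈ F, ∀ i, μ i Q ≠ ∞ := by
    intro Q hQ i
    rw [hμQ Q hQ i]
    obtain ⟨c, l, _, rfl⟩ := grid_cube s (hF Q hQ)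
    exact hfin i c l
  have hfμ : ∀ Q ∈ F, ∀ i, ∫⁻ x in Q, f i x ∂(μ i) = ∫⁻ x in Q, f i x * σ i x := by
    intro Q hQ i
    rw [hμ, setLIntegral_withDensity_eq_setLIntegral_mul _ (hσ i) (hf i) (hmeasF Q hQ)]
    simp only [Pi.mul_apply, mul_comm]
  have hfpμ : ∀ i, ∫⁻ x, f i x ^ p i ∂(μ i) = ∫⁻ x, f i x ^ p i * σ i x := by
    intro i
    rw [hμ, lintegral_withDensity_eq_lintegral_mul _ (hσ i) ((hf i).pow_const _)]
    simp only [Pi.mul_apply, mul_comm]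
  have hfint : ∀ Q ∈ F, ∀ i, ∫⁻ x in Q, f i x ∂(μ i) ≠ ∞ := by
    intro Q hQ i
    have h1 : ∫⁻ x in Q, f i x ∂(μ i) ≤ μ i Q + ∫⁻ x, f i x ^ p i ∂(μ i) := by
      calc ∫⁻ x in Q, f i x ∂(μ i) ≤ ∫⁻ x in Q, (1 + f i x ^ p i) ∂(μ i) := by
            apply lintegral_mono
            intro x
            simp only
            rcases le_total (f i x) 1 with h | h
            · exact h.trans le_self_add
            · refine le_trans ?_ le_add_self
              conv_lhs => rw [← ENNReal.rpow_one (f i x)]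
              exact ENNReal.rpow_le_rpow_of_exponent_le h (hp i).le
        _ = μ i Q + ∫⁻ x in Q, f i x ^ p i ∂(μ i) := by
            rw [lintegral_add_left measurable_const]; simp
        _ ≤ _ := by gcongr; exact Measure.restrict_le_self
    refine ne_top_of_le_ne_top ?_ h1
    rw [hfpμ]
    exact ENNReal.add_ne_top.2 ⟨hμt Q hQ i, hfp i⟩
  have key := finite_main hm μ (volume.withDensity v) f hf p hp q hqp (fun Q => AA m α σ Q ^ q)
    (sawyerM n m α q p σ v ^ q) F hmeasF (grid_lam s F hF) hμt hfint (by
      intro R hR hR0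
      simp only [hμQ R hR] at hR0 ⊢
      exact testing_ineq m hm α q p hp hqp σ v hv hfin s F hF R hR hR0)
  simp only [hfpμ] at key
  refine le_trans (lintegral_mono fun x => ?_) key
  refine iSup₂_mono fun Q hQ => ?_
  refine Set.indicator_le_indicator (le_of_eq ?_)
  rw [ENNReal.prod_rpow_of_nonneg hq.le, ← ENNReal.mul_rpow_of_nonneg _ _ hq.le]
  congr 1
  unfold AA
  rw [← Finset.prod_mul_distrib]
  refine Finset.prod_congr rfl fun i _ => ?_
  rw [mul_assoc]
  congr 1
  have e1 : ∫⁻ y in Q, σ i y = μ i Q := (hμQ Q hQ i).symm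
  rw [e1, ← hfμ Q hQ i, avg]
  by_cases h0 : μ i Q = 0
  · rw [Measure.restrict_eq_zero.2 h0, h0]; simp
  · rw [← mul_assoc, ENNReal.mul_inv_cancel h0 (hμt Q hQ i), one_mul]

def CC (n m : ℕ) (α q : ℝ) (p : Fin m → ℝ) : ℝ≥0∞ :=
  (∏ _i : Fin m, ((6:ℝ≥0∞) ^ n) ^ (1 - α / ((m : ℝ) * (n : ℝ)))) *
    ((2:ℝ≥0∞) ^ n) ^ (1 / q) * ∏ i, Cp (p i) ^ (1 / p i)

lemma full_bound (m : ℕ) (hm : 0 < m) (α q : ℝ) (hβ : 0 < 1 - α / ((m : ℝ) * (n : ℝ)))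
    (p : Fin m → ℝ) (hp : ∀ i, 1 < p i)
    (hqp : ∀ i, p i ≤ q) (σ : Fin m → Rn n → ℝ≥0∞) (hσ : ∀ i, Measurable (σ i))
    (v : Rn n → ℝ≥0∞) (hv : Measurable v)
    (hfin : ∀ i (c : Rn n) (l : ℝ), wtI (σ i) (cube c l) ≠ ∞)
    (f : Fin m → Rn n → ℝ≥0∞) (hf : ∀ i, Measurable (f i))
    (hfp : ∀ i, ∫⁻ x, f i x ^ p i * σ i x ≠ ∞) :
    (∫⁻ x, MM n m α (fun i y => f i y * σ i y) x ^ q * v x) ^ (1/q) ≤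
      CC n m α q p * sawyerM n m α q p σ v * ∏ i, (∫⁻ x, f i x ^ p i * σ i x) ^ (1/p i) := by
  have hq : 0 < q := by have := hp ⟨0, hm⟩; have := hqp ⟨0, hm⟩; linarith
  set g : Fin m → Rn n → ℝ≥0∞ := fun i y => f i y * σ i y with hg
  set D := ∏ _i : Fin m, ((6:ℝ≥0∞) ^ n) ^ (1 - α / ((m : ℝ) * (n : ℝ))) with hD
  set S := sawyerM n m α q p σ v with hS
  set G : (s : Fin n → Fin 2) → Finset (grid s) → Rn n → ℝ≥0∞ := fun s F x =>
    ⨆ Q ∈ F.map (Function.Embedding.subtype _), Set.indicator Q (fun _ => AA m α g Q ^ q) x with hG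
  have hGm : ∀ s F, Measurable (G s F) := by
    intro s F
    refine Measurable.biSup (_ : Set (Set (Rn n))) (Finset.countable_toSet (F.map (Function.Embedding.subtype _))) ?_
    intro Q hQ
    obtain ⟨Q', hQ', rfl⟩ := Finset.mem_map.1 hQ
    obtain ⟨c, l, _, h⟩ := grid_cube s Q'.2
    refine measurable_const.indicator ?_
    simp only [Function.Embedding.subtype_apply]
    rw [h]; exact cube_meas c l
  have hcount : ∀ s : Fin n → Fin 2, Countable (grid s) := fun s =>
    (Set.countable_range _).to_subtype
  have hGsm : ∀ s, Measurable (fun x => ⨆ F, G s F x) := fun s => by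
    have := hcount s
    exact Measurable.iSup (hGm s)
  have hT : ∀ s F, ∫⁻ x, G s F x ∂(volume.withDensity v) ≤
      S ^ q * ∏ i, (Cp (p i) * ∫⁻ x, f i x ^ p i * σ i x) ^ (q / p i) := by
    intro s F
    refine grid_bound m hm α q p hp hqp σ hσ v hv hfin f hf hfp s _ ?_
    intro Q hQ
    obtain ⟨Q', hQ', rfl⟩ := Finset.mem_map.1 hQ
    exact Q'.2
  have hTs : ∀ s, ∫⁻ x, (⨆ F, G s F x) ∂(volume.withDensity v) ≤
      S ^ q * ∏ i, (Cp (p i) * ∫⁻ x, f i x ^ p i * σ i x) ^ (q / p i) := by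
    intro s
    have := hcount s
    rw [lintegral_iSup_directed_of_measurable (hGm s)]
    · exact iSup_le (hT s)
    · classical
      apply Monotone.directed_le
      intro F F' hFF x
      exact biSup_mono (fun Q hQ => Finset.map_subset_map.2 hFF hQ)
  have hmain : ∫⁻ x, MM n m α g x ^ q * v x ≤
      D ^ q * ((2:ℝ≥0∞) ^ n * (S ^ q * ∏ i, (Cp (p i) * ∫⁻ x, f i x ^ p i * σ i x) ^ (q / p i))) := by
    calc ∫⁻ x, MM n m α g x ^ q * v x
        ≤ ∫⁻ x, (v * fun x => D ^ q * ∑ s : Fin n → Fin 2, ⨆ F, G s F x) x := by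
          apply lintegral_mono
          intro x
          simp only [Pi.mul_apply]
          rw [mul_comm]
          gcongr
          exact MM_le m α hβ g q hq x
      _ = ∫⁻ x, D ^ q * ∑ s : Fin n → Fin 2, ⨆ F, G s F x ∂(volume.withDensity v) := by
          rw [lintegral_withDensity_eq_lintegral_mul _ hv]
          exact (Finset.measurable_fun_sum _ (fun s _ => hGsm s)).const_mul _
      _ = D ^ q * ∑ s : Fin n → Fin 2, ∫⁻ x, ⨆ F, G s F x ∂(volume.withDensity v) := by
          rw [lintegral_const_mul _ (Finset.measurable_fun_sum _ (fun s _ => hGsm s)),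
            lintegral_finsetSum _ (fun s _ => hGsm s)]
      _ ≤ D ^ q * ∑ s : Fin n → Fin 2,
            (S ^ q * ∏ i, (Cp (p i) * ∫⁻ x, f i x ^ p i * σ i x) ^ (q / p i)) := by
          gcongr with s
          exact hTs s
      _ = _ := by
          rw [Finset.sum_const, nsmul_eq_mul]
          simp
  have hq1 : 0 ≤ 1 / q := by positivity
  refine (ENNReal.rpow_le_rpow hmain hq1).trans (le_of_eq ?_)
  rw [ENNReal.mul_rpow_of_nonneg _ _ hq1, ENNReal.mul_rpow_of_nonneg _ _ hq1,
    ENNReal.mul_rpow_of_nonneg _ _ hq1, ← ENNReal.rpow_mul, ← ENNReal.rpow_mul,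
    mul_one_div_cancel hq.ne', ENNReal.rpow_one, ENNReal.rpow_one,
    ← ENNReal.prod_rpow_of_nonneg hq1]
  have e : ∏ i, ((Cp (p i) * ∫⁻ x, f i x ^ p i * σ i x) ^ (q / p i)) ^ (1 / q) =
      (∏ i, Cp (p i) ^ (1 / p i)) * ∏ i, (∫⁻ x, f i x ^ p i * σ i x) ^ (1/p i) := by
    rw [← Finset.prod_mul_distrib]
    refine Finset.prod_congr rfl fun i _ => ?_
    have hpi := hp i
    rw [← ENNReal.mul_rpow_of_nonneg _ _ (by positivity), ← ENNReal.rpow_mul]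
    congr 1
    field_simp
  rw [e, CC]
  ring

lemma MM_zero (m : ℕ) (α : ℝ) (g : Fin m → Rn n → ℝ≥0∞) (i : Fin m) (hi : ∫⁻ x, g i x = 0)
    (x : Rn n) : MM n m α g x = 0 := by
  unfold MM
  rw [← nonpos_iff_eq_zero]
  refine iSup_le fun c => iSup_le fun l => iSup_le fun hl => iSup_le fun hx => le_of_eq ?_
  refine Finset.prod_eq_zero (Finset.mem_univ i) ?_
  have : ∫⁻ y in cube c l, g i y = 0 := by
    rw [← nonpos_iff_eq_zero, ← hi]; exact setLIntegral_le_lintegral _ _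
  rw [this, mul_zero]

lemma LHS_zero (m : ℕ) (α q : ℝ) (hq : 0 < q) (p : Fin m → ℝ) (hp : ∀ i, 1 < p i)
    (σ : Fin m → Rn n → ℝ≥0∞) (hσ : ∀ i, Measurable (σ i)) (v : Rn n → ℝ≥0∞)
    (f : Fin m → Rn n → ℝ≥0∞) (hf : ∀ i, Measurable (f i))
    (h : ∏ i, (∫⁻ x, f i x ^ p i * σ i x) ^ (1/p i) = 0) :
    (∫⁻ x, MM n m α (fun i y => f i y * σ i y) x ^ q * v x) ^ (1/q) = 0 := by
  obtain ⟨i, -, hi⟩ := Finset.prod_eq_zero_iff.1 h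
  have hpi := hp i
  rw [ENNReal.rpow_eq_zero_iff_of_pos (by positivity),
    lintegral_eq_zero_iff (by have := (hf i).pow_const (p i); have := hσ i; fun_prop)] at hi
  have h0 : ∫⁻ x, f i x * σ i x = 0 := by
    rw [lintegral_eq_zero_iff (by have := hf i; have := hσ i; fun_prop)]
    filter_upwards [hi] with x hx
    simp only [Pi.zero_apply, mul_eq_zero] at hx ⊢
    rcases hx with hx | hx
    · left; exact (ENNReal.rpow_eq_zero_iff_of_pos (by linarith)).1 hx
    · right; exact hx
  have := MM_zero m α (fun i y => f i y * σ i y) i h0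
  simp [this, hq]

lemma sup_bound (m : ℕ) (hm : 0 < m) (α q : ℝ) (hβ : 0 < 1 - α / ((m : ℝ) * (n : ℝ)))
    (p : Fin m → ℝ) (hp : ∀ i, 1 < p i)
    (hqp : ∀ i, p i ≤ q) (σ : Fin m → Rn n → ℝ≥0∞) (hσ : ∀ i, Measurable (σ i))
    (v : Rn n → ℝ≥0∞) (hv : Measurable v)
    (hfin : ∀ i (c : Rn n) (l : ℝ), wtI (σ i) (cube c l) ≠ ∞)
    (f : Fin m → Rn n → ℝ≥0∞) (hf : ∀ i, Measurable (f i)) :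
    (∫⁻ x, MM n m α (fun i y => f i y * σ i y) x ^ q * v x) ^ (1/q) ≤
        CC n m α q p * sawyerM n m α q p σ v * ∏ i, (∫⁻ x, f i x ^ p i * σ i x) ^ (1/p i)
      ∨ ∏ i, (∫⁻ x, f i x ^ p i * σ i x) ^ (1/p i) = ∞ := by
  have hq : 0 < q := by have := hp ⟨0, hm⟩; have := hqp ⟨0, hm⟩; linarith
  by_cases h0 : ∏ i, (∫⁻ x, f i x ^ p i * σ i x) ^ (1/p i) = 0
  · left; rw [LHS_zero m α q hq p hp σ hσ v f hf h0]; exact zero_le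
  by_cases ht : ∃ i, ∫⁻ x, f i x ^ p i * σ i x = ∞
  · right
    obtain ⟨i, hi⟩ := ht
    have hpi := hp i
    rw [← Finset.mul_prod_erase _ _ (Finset.mem_univ i), hi,
      ENNReal.top_rpow_of_pos (by positivity)]
    refine ENNReal.top_mul ?_
    replace h0 := Finset.prod_ne_zero_iff.1 h0
    rw [Finset.prod_ne_zero_iff]
    intro j _
    exact h0 j (Finset.mem_univ j)
  · left
    push Not at ht
    exact full_bound m hm α q hβ p hp hqp σ hσ v hv hfin f hf ht

lemma CC_ne_top (m : ℕ) (α q : ℝ) (hβ : 0 < 1 - α / ((m : ℝ) * (n : ℝ))) (hq : 0 < q)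
    (p : Fin m → ℝ) (hp : ∀ i, 1 < p i) : CC n m α q p ≠ ∞ := by
  unfold CC
  refine ENNReal.mul_ne_top (ENNReal.mul_ne_top ?_ ?_) ?_
  · exact ENNReal.prod_ne_top fun i _ => ENNReal.rpow_ne_top_of_nonneg hβ.le (by finiteness)
  · exact ENNReal.rpow_ne_top_of_nonneg (by positivity) (by finiteness)
  · refine ENNReal.prod_ne_top fun i _ => ENNReal.rpow_ne_top_of_nonneg ?_ (Cp_ne_top (hp i))
    have := hp i
    positivity

lemma sawyer_le (m : ℕ) (α q : ℝ) (hq : 0 < q) (p : Fin m → ℝ) (hp : ∀ i, 1 < p i)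
    (σ : Fin m → Rn n → ℝ≥0∞) (v : Rn n → ℝ≥0∞) :
    sawyerM n m α q p σ v
          ≤ (⨆ (f : Fin m → Rn n → ℝ≥0∞) (_ : ∀ i, Measurable (f i)),
              (∫⁻ x, MM n m α (fun i y => f i y * σ i y) x ^ q * v x) ^ (1/q) /
                ∏ i, (∫⁻ x, f i x ^ p i * σ i x) ^ (1/p i)) := by
  unfold sawyerM
  refine iSup_le fun c => iSup_le fun l => iSup_le fun hl => ?_
  refine le_iSup₂_of_le (fun _ => (cube c l).indicator (fun _ => 1))
    (fun _ => measurable_const.indicator (cube_meas c l)) ?_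
  have e1 : (fun i => (cube c l).indicator (σ i)) =
      fun i y => (cube c l).indicator (fun _ => (1:ℝ≥0∞)) y * σ i y := by
    funext i y
    by_cases h : y ∈ cube c l <;> simp [h]
  have e2 : ∀ i, ∫⁻ x, (cube c l).indicator (fun _ => (1:ℝ≥0∞)) x ^ p i * σ i x = wtI (σ i) (cube c l) := by
    intro i
    rw [wtI, ← lintegral_indicator (cube_meas c l)]
    apply lintegral_congr
    intro y
    have : 0 < p i := by linarith [hp i]
    by_cases h : y ∈ cube c l <;> simp [h, this]
  simp only [e2]
  rw [e1]
  refine ENNReal.div_le_div_right (ENNReal.rpow_le_rpow (setLIntegral_le_lintegral _ _) ?_) _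
  positivity

end gridsec

/-- Main theorem: `ℳ_α` is bounded from
`L^{p₁}(w₁)×⋯×L^{p_m}(w_m)` to `L^q(v)` iff the Sawyer testing constant is
finite, with comparability of norms. -/
theorem stmt12 (n m : ℕ) (hn : 0 < n) (hm : 0 < m) (α : ℝ) (hα0 : 0 ≤ α)
    (hα : α < m * n) (p : Fin m → ℝ) (hp : ∀ i, 1 < p i) (pp q : ℝ)
    (hpp : 1/pp = ∑ i, 1/p i) (hq : 1/q = 1/pp - α/n) (hqp : ∀ i, p i ≤ q) :
    ∃ C : ℝ≥0∞, C ≠ ∞ ∧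
      ∀ (w : Fin m → Rn n → ℝ≥0∞) (v : Rn n → ℝ≥0∞) (σ : Fin m → Rn n → ℝ≥0∞),
        (∀ i, Measurable (w i)) → Measurable v →
        (σ = fun i x => w i x ^ (1 - p i/(p i - 1))) →
        (∀ i (c : Rn n) (l : ℝ), wtI (σ i) (cube c l) ≠ ∞) →
        (∀ (c : Rn n) (l : ℝ), wtI v (cube c l) ≠ ∞) →
        ((∃ N : ℝ≥0∞, N ≠ ∞ ∧ ∀ f : Fin m → Rn n → ℝ≥0∞, (∀ i, Measurable (f i)) →
            (∫⁻ x, MM n m α (fun i y => f i y * σ i y) x ^ q * v x) ^ (1/q)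
              ≤ N * ∏ i, (∫⁻ x, f i x ^ p i * σ i x) ^ (1/p i))
          ↔ sawyerM n m α q p σ v ≠ ∞) ∧
        sawyerM n m α q p σ v
          ≤ (⨆ (f : Fin m → Rn n → ℝ≥0∞) (_ : ∀ i, Measurable (f i)),
              (∫⁻ x, MM n m α (fun i y => f i y * σ i y) x ^ q * v x) ^ (1/q) /
                ∏ i, (∫⁻ x, f i x ^ p i * σ i x) ^ (1/p i)) ∧
        (⨆ (f : Fin m → Rn n → ℝ≥0∞) (_ : ∀ i, Measurable (f i)),
              (∫⁻ x, MM n m α (fun i y => f i y * σ i y) x ^ q * v x) ^ (1/q) /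
                ∏ i, (∫⁻ x, f i x ^ p i * σ i x) ^ (1/p i))
          ≤ C * sawyerM n m α q p σ v := by
  have hq0 : 0 < q := by have := hp ⟨0, hm⟩; have := hqp ⟨0, hm⟩; linarith
  have hmn : (0:ℝ) < (m:ℝ) * n := by positivity
  have hβ : 0 < 1 - α / ((m : ℝ) * (n : ℝ)) := by
    rw [sub_pos, div_lt_one hmn]; exact hα
  refine ⟨CC n m α q p, CC_ne_top m α q hβ hq0 p hp, ?_⟩
  intro w v σ hw hv hσw hfin _
  have hσ : ∀ i, Measurable (σ i) := by
    intro i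
    rw [hσw]
    exact (hw i).pow_const _
  have hb := sup_bound m hm α q hβ p hp hqp σ hσ v hv hfin
  have hle := sawyer_le m α q hq0 p hp σ v
  refine ⟨⟨?_, ?_⟩, hle, ?_⟩
  · rintro ⟨N, hN, h⟩
    refine ne_top_of_le_ne_top hN (hle.trans ?_)
    exact iSup₂_le fun f hf => ENNReal.div_le_of_le_mul (h f hf)
  · intro hS
    refine ⟨CC n m α q p * sawyerM n m α q p σ v + 1,
      ENNReal.add_ne_top.2 ⟨ENNReal.mul_ne_top (CC_ne_top m α q hβ hq0 p hp) hS, by simp⟩, ?_⟩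
    intro f hf
    rcases hb f hf with h | h
    · exact h.trans (by gcongr; exact le_self_add)
    · rw [h, ENNReal.mul_top (by simp)]; exact le_top
  · refine iSup₂_le fun f hf => ?_
    rcases hb f hf with h | h
    · exact ENNReal.div_le_of_le_mul h
    · rw [h]; simp
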